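/- arXiv:2508.12901 — 2 statements merged into one kernel-verified Lean document; each statement's English description precedes it below -/
import Mathlib

section
/- Let H be a finite-dimensional complex Hilbert space, r > 0, and n ∈ ℕ. For any convex sets A_n, B_n of quantum states on H^{⊗n}, the worst-case optimal type-I error equals the optimal type-I error for the hardest pair of states: α_{n,r}(A_n‖B_n) = sup_{ρ_n∈A_n, σ_n∈B_n} α_{n,r}(ρ_n‖σ_n). -/
open Filter Set
open scoped ComplexOrder Classical

noncomputable section

/-- The index type of the `n`-fold tensor power of a `d`-dimensional Hilbert space. -/
abbrev TIdx (d n : ℕ) := Fin n → Fin d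

/-- Operators on the `n`-fold tensor power of a `d`-dimensional complex Hilbert space. -/
abbrev Mat (d n : ℕ) := Matrix (TIdx d n) (TIdx d n) ℂ

/-- A quantum state: positive semidefinite with unit trace. -/
def IsState {d n : ℕ} (ρ : Mat d n) : Prop := ρ.PosSemidef ∧ ρ.trace = 1

/-- Tensor product of an operator on `H^{⊗m}` and one on `H^{⊗n}`, as an operator on
`H^{⊗(m+n)}`. -/
def tensorProd {d m n : ℕ} (A : Mat d m) (B : Mat d n) : Mat d (m + n) :=
  Matrix.of fun f g =>
    A (fun i => f (Fin.castAdd n i)) (fun i => g (Fin.castAdd n i)) *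
      B (fun j => f (Fin.natAdd m j)) (fun j => g (Fin.natAdd m j))

/-- `suppLE ρ σ` means the support of `ρ` is contained in the support of `σ`
(equivalently, `ker σ ⊆ ker ρ` for Hermitian PSD matrices). -/
def suppLE {d n : ℕ} (ρ σ : Mat d n) : Prop :=
  ∀ v : TIdx d n → ℂ, σ.mulVec v = 0 → ρ.mulVec v = 0

/-- Real matrix power via the functional calculus (junk value `0` for non-Hermitian input);
powers are taken on the support since `(0:ℝ) ^ p = 0` for `p ≠ 0`. -/
def mpow {d n : ℕ} (A : Mat d n) (p : ℝ) : Mat d n :=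
  if h : A.IsHermitian then
    (h.eigenvectorUnitary : Mat d n) *
      Matrix.diagonal (fun i => ((h.eigenvalues i ^ p : ℝ) : ℂ)) *
      (star (h.eigenvectorUnitary : Mat d n))
  else 0

/-- Matrix base-2 logarithm via the functional calculus, taken on the support. -/
def mlog {d n : ℕ} (A : Mat d n) : Mat d n :=
  if h : A.IsHermitian then
    (h.eigenvectorUnitary : Mat d n) *
      Matrix.diagonal (fun i => ((Real.logb 2 (h.eigenvalues i) : ℝ) : ℂ)) *
      (star (h.eigenvectorUnitary : Mat d n))
  else 0

/-- The Petz quasi-divergence quantity `tr[ρ^α σ^{1-α}]`. -/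
def qPetz {d n : ℕ} (α : ℝ) (ρ σ : Mat d n) : ℝ :=
  (mpow ρ α * mpow σ (1 - α)).trace.re

/-- The Petz Rényi divergence (base-2), `+∞` unless `supp ρ ⊆ supp σ`. -/
def DPetz {d n : ℕ} (α : ℝ) (ρ σ : Mat d n) : EReal :=
  if suppLE ρ σ then (((α - 1)⁻¹ * Real.logb 2 (qPetz α ρ σ) : ℝ) : EReal) else ⊤

/-- The sandwiched quasi-divergence quantity `tr[(σ^{(1-α)/(2α)} ρ σ^{(1-α)/(2α)})^α]`. -/
def qSand {d n : ℕ} (α : ℝ) (ρ σ : Mat d n) : ℝ :=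
  (mpow (mpow σ ((1 - α) / (2 * α)) * ρ * mpow σ ((1 - α) / (2 * α))) α).trace.re

/-- The sandwiched Rényi divergence (base-2), `+∞` unless `supp ρ ⊆ supp σ`. -/
def DSand {d n : ℕ} (α : ℝ) (ρ σ : Mat d n) : EReal :=
  if suppLE ρ σ then (((α - 1)⁻¹ * Real.logb 2 (qSand α ρ σ) : ℝ) : EReal) else ⊤

/-- The quantum Hoeffding divergence `H_{n,r}(ρ‖σ)`. -/
def Hoeffding {d : ℕ} (n : ℕ) (r : ℝ) (ρ σ : Mat d n) : EReal :=
  ⨆ α ∈ Set.Ioo (0 : ℝ) 1,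
    (((α - 1) / α : ℝ) : EReal) * ((((n : ℝ) * r : ℝ) : EReal) - DPetz α ρ σ)

/-- The quantum Hoeffding anti-divergence `H*_{n,r}(ρ‖σ)`. -/
def HoeffdingA {d : ℕ} (n : ℕ) (r : ℝ) (ρ σ : Mat d n) : EReal :=
  ⨆ α ∈ Set.Ioi (1 : ℝ),
    (((α - 1) / α : ℝ) : EReal) * ((((n : ℝ) * r : ℝ) : EReal) - DSand α ρ σ)

/-- Petz Rényi divergence between two sets of states. -/
def DPetzSet {d n : ℕ} (α : ℝ) (A B : Set (Mat d n)) : EReal :=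
  ⨅ ρ ∈ A, ⨅ σ ∈ B, DPetz α ρ σ

/-- Sandwiched Rényi divergence between two sets of states. -/
def DSandSet {d n : ℕ} (α : ℝ) (A B : Set (Mat d n)) : EReal :=
  ⨅ ρ ∈ A, ⨅ σ ∈ B, DSand α ρ σ

/-- Quantum Hoeffding divergence between two sets of states. -/
def HoeffdingSet {d : ℕ} (n : ℕ) (r : ℝ) (A B : Set (Mat d n)) : EReal :=
  ⨅ ρ ∈ A, ⨅ σ ∈ B, Hoeffding n r ρ σ

/-- Quantum Hoeffding anti-divergence between two sets of states. -/
def HoeffdingASet {d : ℕ} (n : ℕ) (r : ℝ) (A B : Set (Mat d n)) : EReal :=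
  ⨆ ρ ∈ A, ⨆ σ ∈ B, HoeffdingA n r ρ σ

/-- A test (two-outcome POVM element): `0 ≤ M ≤ I`. -/
def IsTest {d n : ℕ} (M : Mat d n) : Prop := M.PosSemidef ∧ (1 - M).PosSemidef

/-- Worst-case type-I error of a test `M` for the set `A`. -/
def typeI {d n : ℕ} (A : Set (Mat d n)) (M : Mat d n) : ℝ :=
  ⨆ ρ ∈ A, (ρ * (1 - M)).trace.re

/-- Worst-case type-II error of a test `M` for the set `B`. -/
def typeII {d n : ℕ} (B : Set (Mat d n)) (M : Mat d n) : ℝ :=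
  ⨆ σ ∈ B, (σ * M).trace.re

/-- Optimal type-I error at type-II error exponent `r`:
`α_{n,r}(A‖B) = inf { α(A,M) : 0 ≤ M ≤ I, β(B,M) ≤ 2^{-nr} }`. -/
def optAlpha {d : ℕ} (n : ℕ) (r : ℝ) (A B : Set (Mat d n)) : ℝ :=
  sInf {x | ∃ M : Mat d n, IsTest M ∧ typeII B M ≤ (2 : ℝ) ^ (-((n : ℝ) * r)) ∧ x = typeI A M}

/-- Optimal type-I error for a single pair of states. -/
def optAlphaPair {d : ℕ} (n : ℕ) (r : ℝ) (ρ σ : Mat d n) : ℝ :=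
  optAlpha n r {ρ} {σ}

/-- `- log₂ x` as an extended real, with `-log₂ 0 = +∞`. -/
def negLog2 (x : ℝ) : EReal := if x = 0 then ⊤ else ((-Real.logb 2 x : ℝ) : EReal)

/-- A sequence of sets of operators is stable under tensor product. -/
def Stable {d : ℕ} (A : ∀ n : ℕ, Set (Mat d n)) : Prop :=
  ∀ m n : ℕ, ∀ X ∈ A m, ∀ Y ∈ A n, tensorProd X Y ∈ A (m + n)

/-- Invariance under conjugation by the unitaries permuting the tensor factors. -/
def PermInvariant {d n : ℕ} (C : Set (Mat d n)) : Prop :=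
  ∀ π : Equiv.Perm (Fin n), ∀ M ∈ C,
    Matrix.of (fun f g : TIdx d n => M (f ∘ π) (g ∘ π)) ∈ C

/-- The polar of a set of positive semidefinite operators. -/
def polar {d n : ℕ} (C : Set (Mat d n)) : Set (Mat d n) :=
  {X | X.PosSemidef ∧ ∀ Y ∈ C, (X * Y).trace.re ≤ 1}

/-- Max-relative entropy between two sets (base-2):
`inf_{ρ∈A,σ∈B} log inf {λ ≥ 0 : ρ ≤ λσ}`. -/
def DmaxSet {d n : ℕ} (A B : Set (Mat d n)) : EReal :=
  ⨅ ρ ∈ A, ⨅ σ ∈ B, ⨅ lam ∈ {l : ℝ | 0 ≤ l ∧ (l • σ - ρ).PosSemidef},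
    ((Real.logb 2 lam : ℝ) : EReal)

/-- Umegaki relative entropy (base-2), `+∞` unless `supp ρ ⊆ supp σ`. -/
def DUm {d n : ℕ} (ρ σ : Mat d n) : EReal :=
  if suppLE ρ σ then (((ρ * (mlog ρ - mlog σ)).trace.re : ℝ) : EReal) else ⊤

/-- Umegaki relative entropy between two sets. -/
def DUmSet {d n : ℕ} (A B : Set (Mat d n)) : EReal :=
  ⨅ ρ ∈ A, ⨅ σ ∈ B, DUm ρ σ

/-- Spectral projection onto the nonnegative eigenspace of a matrix
(junk value `0` for non-Hermitian input). -/
def posProj {d n : ℕ} (X : Mat d n) : Mat d n :=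
  if h : X.IsHermitian then
    (h.eigenvectorUnitary : Mat d n) *
      Matrix.diagonal (fun i => if 0 ≤ h.eigenvalues i then (1 : ℂ) else 0) *
      (star (h.eigenvectorUnitary : Mat d n))
  else 0

/-- A finite system of affine inequalities `L i x ≤ b i` that has no solution in a compact convex
set admits a nonnegative combination that is violated on the whole set. -/
theorem exists_nonneg_weights_of_infeasible {E ι : Type*} [AddCommGroup E] [Module ℝ E]
    [TopologicalSpace E] [Fintype ι] {K : Set E} (hK : IsCompact K) (hKconv : Convex ℝ K)
    (L : ι → E →ₗ[ℝ] ℝ) (hL : ∀ i, Continuous (L i)) (b : ι → ℝ)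
    (h : ∀ x ∈ K, ∃ i, b i < L i x) :
    ∃ c : ι → ℝ, (∀ i, 0 ≤ c i) ∧ ∀ x ∈ K, ∑ i, c i * b i < ∑ i, c i * L i x := by
  have hdisj : Disjoint (LinearMap.pi L '' K) (Iic b) := by
    rw [Set.disjoint_left]
    rintro _ ⟨x, hx, rfl⟩ hle
    obtain ⟨i, hi⟩ := h x hx
    exact (hle i).not_gt hi
  obtain ⟨f, u, v, hu, huv, hv⟩ := geometric_hahn_banach_compact_closed
    (hKconv.linear_image (LinearMap.pi L)) (hK.image (continuous_pi hL))
    (convex_Iic b) isClosed_Iic hdisj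
  have hf (y : ι → ℝ) : f y = ∑ i, f (Pi.single i 1) * y i := by
    conv_lhs => rw [← Finset.univ_sum_single y, map_sum]
    refine Finset.sum_congr rfl fun i _ => ?_
    have : (Pi.single i (y i) : ι → ℝ) = y i • Pi.single i 1 := by
      rw [← Pi.single_smul, smul_eq_mul, mul_one]
    rw [this, map_smul, smul_eq_mul, mul_comm]
  refine ⟨fun i => -f (Pi.single i 1), fun i => ?_, fun x hx => ?_⟩
  · by_contra! hneg
    have hpos : 0 < f (Pi.single i 1) := by linarith
    set t : ℝ := max 0 ((f b - v) / f (Pi.single i 1))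
    have hmem : b - t • Pi.single i 1 ∈ Iic b := by
      refine sub_le_self b (smul_nonneg (le_max_left _ _) ?_)
      exact Pi.single_nonneg.2 zero_le_one
    have hlt := hv _ hmem
    rw [map_sub, map_smul, smul_eq_mul] at hlt
    have : (f b - v) / f (Pi.single i 1) ≤ t := le_max_right _ _
    rw [div_le_iff₀ hpos] at this
    linarith
  · have h1 := hu _ (mem_image_of_mem _ hx)
    have h2 := hv b self_mem_Iic
    rw [hf] at h1 h2
    simp only [LinearMap.pi_apply] at h1
    simp only [neg_mul, Finset.sum_neg_distrib]
    linarith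

theorem Convex.exists_sum_smul_eq {V ι : Type*} [AddCommGroup V] [Module ℝ V] [Fintype ι]
    {A : Set V} (hA : Convex ℝ A) (hne : A.Nonempty) {c : ι → ℝ} (hc : ∀ i, 0 ≤ c i)
    {z : ι → V} (hz : ∀ i, z i ∈ A) :
    ∃ a ∈ A, ∑ i, c i • z i = (∑ i, c i) • a := by
  rcases (Finset.sum_nonneg fun i _ => hc i : 0 ≤ ∑ i, c i).eq_or_lt with h0 | hpos
  · obtain ⟨a, ha⟩ := hne
    refine ⟨a, ha, ?_⟩
    rw [eq_comm, Finset.sum_eq_zero_iff_of_nonneg fun i _ => hc i] at h0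
    simp [fun i => h0 i (Finset.mem_univ i)]
  · refine ⟨Finset.univ.centerMass c z,
      hA.centerMass_mem (fun i _ => hc i) hpos fun i _ => hz i, ?_⟩
    rw [Finset.centerMass, smul_inv_smul₀ hpos.ne']

/-- If every pair of constraints, one from each of two convex families, can be satisfied in a
compact convex set, then all the constraints can be satisfied simultaneously. -/
theorem exists_forall_le_of_forall_pair {V W E : Type*} [AddCommGroup V] [Module ℝ V]
    [AddCommGroup W] [Module ℝ W] [AddCommGroup E] [Module ℝ E] [TopologicalSpace E]
    {K : Set E} (hK : IsCompact K) (hKconv : Convex ℝ K)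
    (p : V →ₗ[ℝ] E →ₗ[ℝ] ℝ) (hp : ∀ v, Continuous (p v))
    (q : W →ₗ[ℝ] E →ₗ[ℝ] ℝ) (hq : ∀ w, Continuous (q w))
    {A : Set V} {B : Set W} (hA : Convex ℝ A) (hB : Convex ℝ B)
    (hAne : A.Nonempty) (hBne : B.Nonempty) (a b : ℝ)
    (h : ∀ v ∈ A, ∀ w ∈ B, ∃ x ∈ K, p v x ≤ a ∧ q w x ≤ b) :
    ∃ x ∈ K, (∀ v ∈ A, p v x ≤ a) ∧ ∀ w ∈ B, q w x ≤ b := by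
  have hne : (K ∩ ⋂ z : A × B, {x | p z.1 x ≤ a ∧ q z.2 x ≤ b}).Nonempty := by
    refine hK.inter_iInter_nonempty _ (fun z =>
      (isClosed_le (hp _) continuous_const).inter (isClosed_le (hq _) continuous_const))
      fun u => ?_
    by_contra hempty
    obtain ⟨c, hc, hlt⟩ := exists_nonneg_weights_of_infeasible (ι := u ⊕ u) hK hKconv
      (Sum.elim (fun z => p z.1.1) (fun z => q z.1.2))
      (by rintro (z | z); exacts [hp _, hq _]) (Sum.elim (fun _ => a) (fun _ => b)) (by
        intro x hx
        by_contra! hle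
        refine hempty ⟨x, hx, mem_iInter₂.2 fun z hz => ⟨?_, ?_⟩⟩
        · exact hle (Sum.inl ⟨z, hz⟩)
        · exact hle (Sum.inr ⟨z, hz⟩))
    obtain ⟨v, hv, hvsum⟩ := hA.exists_sum_smul_eq hAne (fun z : u => hc (Sum.inl z))
      (fun z => z.1.1.2)
    obtain ⟨w, hw, hwsum⟩ := hB.exists_sum_smul_eq hBne (fun z : u => hc (Sum.inr z))
      (fun z => z.1.2.2)
    obtain ⟨x, hx, hpx, hqx⟩ := h v hv w hw
    have hvx := congrArg (fun y => p y x) hvsum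
    have hwx := congrArg (fun y => q y x) hwsum
    have hltx := hlt x hx
    simp only [map_sum, map_smul, LinearMap.sum_apply, LinearMap.smul_apply, smul_eq_mul]
      at hvx hwx
    simp only [Fintype.sum_sum_type, Sum.elim_inl, Sum.elim_inr] at hltx
    rw [hvx, hwx, ← Finset.sum_mul, ← Finset.sum_mul] at hltx
    have h1 := mul_le_mul_of_nonneg_left hpx
      (Finset.sum_nonneg fun z (_ : z ∈ Finset.univ) => hc (Sum.inl z))
    have h2 := mul_le_mul_of_nonneg_left hqx
      (Finset.sum_nonneg fun z (_ : z ∈ Finset.univ) => hc (Sum.inr z))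
    linarith
  obtain ⟨x, hx, hmem⟩ := hne
  rw [mem_iInter] at hmem
  obtain ⟨v₀, hv₀⟩ := hAne
  obtain ⟨w₀, hw₀⟩ := hBne
  exact ⟨x, hx, fun v hv => (hmem (⟨v, hv⟩, ⟨w₀, hw₀⟩)).1,
    fun w hw => (hmem (⟨v₀, hv₀⟩, ⟨w, hw⟩)).2⟩

open scoped MatrixOrder in
theorem Matrix.PosSemidef.trace_mul_re_nonneg {ι : Type*} [Fintype ι] {X Y : Matrix ι ι ℂ}
    (hX : X.PosSemidef) (hY : Y.PosSemidef) : 0 ≤ (X * Y).trace.re := by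
  obtain ⟨Z, rfl⟩ := CStarAlgebra.nonneg_iff_eq_star_mul_self.1 hX.nonneg
  rw [Matrix.star_eq_conjTranspose, Matrix.mul_assoc, Matrix.trace_mul_comm]
  exact (Complex.nonneg_iff.1 (hY.mul_mul_conjTranspose_same Z).trace_nonneg).1

theorem Real.biSup_le {α : Type*} {s : Set α} {f : α → ℝ} {c : ℝ} (hc : 0 ≤ c)
    (h : ∀ x ∈ s, f x ≤ c) : ⨆ x ∈ s, f x ≤ c :=
  Real.iSup_le (fun x => Real.iSup_le (h x) hc) hc

theorem Real.le_biSup {α : Type*} {s : Set α} {f : α → ℝ} {c : ℝ} (hc : 0 ≤ c)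
    (h : ∀ x ∈ s, f x ≤ c) {x : α} (hx : x ∈ s) : f x ≤ ⨆ x ∈ s, f x := by
  refine le_ciSup_of_le ⟨c, ?_⟩ x (le_ciSup_of_le (Set.finite_range _).bddAbove hx le_rfl)
  rintro _ ⟨y, rfl⟩
  exact Real.iSup_le (h y) hc

theorem Real.biSup_nonneg {α : Type*} {s : Set α} {f : α → ℝ} (h : ∀ x ∈ s, 0 ≤ f x) :
    0 ≤ ⨆ x ∈ s, f x :=
  Real.iSup_nonneg fun x => Real.iSup_nonneg (h x)

theorem Real.biSup_singleton {α : Type*} {f : α → ℝ} {a : α} (h : 0 ≤ f a) :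
    ⨆ x ∈ ({a} : Set α), f x = f a :=
  (Real.biSup_le h fun _ hx => (congrArg f (mem_singleton_iff.1 hx)).le).antisymm
    (Real.le_biSup h (fun _ hx => (congrArg f (mem_singleton_iff.1 hx)).le) (mem_singleton a))

section Tests

variable {d n : ℕ} {ρ σ M : Mat d n} {A B : Set (Mat d n)}

theorem IsState.trace_mul_one_sub_re (hρ : IsState ρ) :
    (ρ * (1 - M)).trace.re = 1 - (ρ * M).trace.re := by
  rw [mul_sub, mul_one, Matrix.trace_sub, hρ.2, Complex.sub_re, Complex.one_re]

theorem IsState.trace_mul_test_nonneg (hρ : IsState ρ) (hM : IsTest M) :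
    0 ≤ (ρ * M).trace.re :=
  hρ.1.trace_mul_re_nonneg hM.1

theorem IsState.trace_mul_one_sub_test_nonneg (hρ : IsState ρ) (hM : IsTest M) :
    0 ≤ (ρ * (1 - M)).trace.re :=
  hρ.1.trace_mul_re_nonneg hM.2

theorem IsState.trace_mul_test_le_one (hρ : IsState ρ) (hM : IsTest M) :
    (ρ * M).trace.re ≤ 1 := by
  linarith [hρ.trace_mul_one_sub_test_nonneg hM, hρ.trace_mul_one_sub_re (M := M)]

theorem IsState.trace_mul_one_sub_test_le_one (hρ : IsState ρ) (hM : IsTest M) :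
    (ρ * (1 - M)).trace.re ≤ 1 := by
  linarith [hρ.trace_mul_test_nonneg hM, hρ.trace_mul_one_sub_re (M := M)]

theorem isTest_zero : IsTest (0 : Mat d n) :=
  ⟨.zero, by rw [sub_zero]; exact .one⟩

theorem isTest_one : IsTest (1 : Mat d n) :=
  ⟨.one, by rw [sub_self]; exact .zero⟩

open scoped MatrixOrder Matrix.Norms.L2Operator in
theorem isCompact_setOf_isTest : IsCompact {M : Mat d n | IsTest M} := by
  have heq : {M : Mat d n | IsTest M} = Icc 0 1 := by
    ext M
    simp [IsTest, Matrix.le_iff]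
  rw [heq]
  have : ProperSpace (Mat d n) := FiniteDimensional.proper ℂ _
  refine Metric.isCompact_of_isClosed_isBounded isClosed_Icc ?_
  refine (Metric.isBounded_closedBall (x := (0 : Mat d n)) (r := 1)).subset fun M hM => ?_
  rw [mem_closedBall_zero_iff]
  exact (CStarAlgebra.norm_le_one_iff_of_nonneg M hM.1).2 hM.2

theorem convex_setOf_isTest : Convex ℝ {M : Mat d n | IsTest M} := by
  rintro M hM N hN s t hs ht hst
  refine ⟨(hM.1.smul hs).add (hN.1.smul ht), ?_⟩
  have : (1 : Mat d n) - (s • M + t • N) = s • (1 - M) + t • (1 - N) := by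
    rw [smul_sub, smul_sub, sub_add_sub_comm, ← add_smul, hst, one_smul]
  rw [this]
  exact (hM.2.smul hs).add (hN.2.smul ht)

/-- The bilinear pairing `(X, Y) ↦ Re tr (X Y)`. -/
def tracePairing (d n : ℕ) : Mat d n →ₗ[ℝ] Mat d n →ₗ[ℝ] ℝ :=
  (LinearMap.mul ℝ (Mat d n)).compr₂
    (Complex.reLm ∘ₗ Matrix.traceLinearMap (TIdx d n) ℝ ℂ)

theorem tracePairing_apply (X Y : Mat d n) : tracePairing d n X Y = (X * Y).trace.re := rfl

theorem continuous_tracePairing (X : Mat d n) : Continuous (tracePairing d n X) :=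
  Complex.continuous_re.comp (continuous_const.matrix_mul continuous_id).matrix_trace

theorem trace_mul_le_typeII (hB : ∀ σ ∈ B, IsState σ) (hM : IsTest M) (hσ : σ ∈ B) :
    (σ * M).trace.re ≤ typeII B M :=
  Real.le_biSup zero_le_one (fun σ hσ => (hB σ hσ).trace_mul_test_le_one hM) hσ

theorem trace_mul_one_sub_le_typeI (hA : ∀ ρ ∈ A, IsState ρ) (hM : IsTest M) (hρ : ρ ∈ A) :
    (ρ * (1 - M)).trace.re ≤ typeI A M :=
  Real.le_biSup zero_le_one (fun ρ hρ => (hA ρ hρ).trace_mul_one_sub_test_le_one hM) hρ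

theorem typeI_nonneg (hA : ∀ ρ ∈ A, IsState ρ) (hM : IsTest M) : 0 ≤ typeI A M :=
  Real.biSup_nonneg fun ρ hρ => (hA ρ hρ).trace_mul_one_sub_test_nonneg hM

theorem typeI_singleton (hρ : IsState ρ) (hM : IsTest M) :
    typeI {ρ} M = (ρ * (1 - M)).trace.re :=
  Real.biSup_singleton (f := fun ρ => (ρ * (1 - M)).trace.re)
    (hρ.trace_mul_one_sub_test_nonneg hM)

theorem typeII_singleton (hσ : IsState σ) (hM : IsTest M) :
    typeII {σ} M = (σ * M).trace.re :=
  Real.biSup_singleton (f := fun σ => (σ * M).trace.re) (hσ.trace_mul_test_nonneg hM)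

variable {r : ℝ}

theorem optAlpha_le (hA : ∀ ρ ∈ A, IsState ρ) (hM : IsTest M)
    (hMB : typeII B M ≤ (2 : ℝ) ^ (-((n : ℝ) * r))) : optAlpha n r A B ≤ typeI A M := by
  refine csInf_le ⟨0, ?_⟩ ⟨M, hM, hMB, rfl⟩
  rintro _ ⟨N, hN, -, rfl⟩
  exact typeI_nonneg hA hN

theorem typeII_zero_le : typeII B (0 : Mat d n) ≤ (2 : ℝ) ^ (-((n : ℝ) * r)) :=
  Real.biSup_le (by positivity) fun σ _ => by
    rw [mul_zero, Matrix.trace_zero, Complex.zero_re]; positivity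

theorem le_optAlpha {c : ℝ} (h : ∀ M : Mat d n, IsTest M →
    typeII B M ≤ (2 : ℝ) ^ (-((n : ℝ) * r)) → c ≤ typeI A M) : c ≤ optAlpha n r A B := by
  refine le_csInf ⟨_, 0, isTest_zero, typeII_zero_le, rfl⟩ ?_
  rintro _ ⟨M, hM, hMB, rfl⟩
  exact h M hM hMB

theorem optAlpha_nonneg (hA : ∀ ρ ∈ A, IsState ρ) : 0 ≤ optAlpha n r A B :=
  le_optAlpha fun _ hM _ => typeI_nonneg hA hM

theorem optAlphaPair_nonneg (hρ : IsState ρ) : 0 ≤ optAlphaPair n r ρ σ :=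
  optAlpha_nonneg (by simpa using hρ)

theorem optAlphaPair_le_optAlpha (hA : ∀ ρ ∈ A, IsState ρ) (hB : ∀ σ ∈ B, IsState σ)
    (hρ : ρ ∈ A) (hσ : σ ∈ B) : optAlphaPair n r ρ σ ≤ optAlpha n r A B :=
  le_optAlpha fun M hM hMB =>
    (optAlpha_le (by simpa using hA ρ hρ) hM
      ((typeII_singleton (hB σ hσ) hM).trans_le ((trace_mul_le_typeII hB hM hσ).trans hMB))).trans
    ((typeI_singleton (hA ρ hρ) hM).trans_le (trace_mul_one_sub_le_typeI hA hM hρ))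

theorem exists_isTest_optAlphaPair (hρ : IsState ρ) (hσ : IsState σ) (r : ℝ) :
    ∃ M : Mat d n, IsTest M ∧ (σ * M).trace.re ≤ (2 : ℝ) ^ (-((n : ℝ) * r)) ∧
      (ρ * (1 - M)).trace.re ≤ optAlphaPair n r ρ σ := by
  have hK : IsCompact ({M : Mat d n | IsTest M} ∩
      {M | (σ * M).trace.re ≤ (2 : ℝ) ^ (-((n : ℝ) * r))}) :=
    isCompact_setOf_isTest.inter_right
      (isClosed_le (continuous_tracePairing σ) continuous_const)
  have hcont : Continuous fun M : Mat d n => (ρ * (1 - M)).trace.re :=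
    (continuous_tracePairing ρ).comp (continuous_const.sub continuous_id)
  obtain ⟨M, ⟨hM, hMσ⟩, hmin⟩ := hK.exists_isMinOn
    ⟨0, isTest_zero, (typeII_singleton hσ isTest_zero).symm.trans_le typeII_zero_le⟩ hcont.continuousOn
  refine ⟨M, hM, hMσ, le_optAlpha fun N hN hNσ => ?_⟩
  rw [typeI_singleton hρ hN]
  exact hmin ⟨hN, (typeII_singleton hσ hN).symm.trans_le hNσ⟩

theorem optAlpha_eq_zero_of_typeI_eq_zero (hA : ∀ ρ ∈ A, IsState ρ) (hM : IsTest M)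
    (hMB : typeII B M ≤ (2 : ℝ) ^ (-((n : ℝ) * r))) (h : typeI A M = 0) :
    optAlpha n r A B = 0 :=
  ((optAlpha_le hA hM hMB).trans_eq h).antisymm (optAlpha_nonneg hA)

end Tests

/-- For convex sets of states, the worst-case optimal type-I error equals the
optimal type-I error for the hardest pair of states. -/
theorem optAlpha_eq_sup_pairs {d n : ℕ} {r : ℝ} (hr : 0 < r) (A B : Set (Mat d n))
    (hAconv : Convex ℝ A) (hAstate : ∀ ρ ∈ A, IsState ρ)
    (hBconv : Convex ℝ B) (hBstate : ∀ σ ∈ B, IsState σ) :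
    optAlpha n r A B = ⨆ ρ ∈ A, ⨆ σ ∈ B, optAlphaPair n r ρ σ := by
  rcases A.eq_empty_or_nonempty with rfl | hAne
  · rw [optAlpha_eq_zero_of_typeI_eq_zero hAstate isTest_zero typeII_zero_le (by simp [typeI])]
    simp
  rcases B.eq_empty_or_nonempty with rfl | hBne
  · rw [optAlpha_eq_zero_of_typeI_eq_zero hAstate isTest_one
      (by simp only [typeII, mem_empty_iff_false, Real.iSup_of_isEmpty, Real.iSup_const_zero]
          positivity)
      (by simp [typeI])]
    simp
  set v := ⨆ ρ ∈ A, ⨆ σ ∈ B, optAlphaPair n r ρ σ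
  have hopt : 0 ≤ optAlpha n r A B := optAlpha_nonneg hAstate
  have hle (ρ) (hρ : ρ ∈ A) (σ) (hσ : σ ∈ B) : optAlphaPair n r ρ σ ≤ optAlpha n r A B :=
    optAlphaPair_le_optAlpha hAstate hBstate hρ hσ
  have hle' (ρ) (hρ : ρ ∈ A) : ⨆ σ ∈ B, optAlphaPair n r ρ σ ≤ optAlpha n r A B :=
    Real.biSup_le hopt (hle ρ hρ)
  refine le_antisymm ?_ (Real.biSup_le hopt hle')
  have hpair (ρ) (hρ : ρ ∈ A) (σ) (hσ : σ ∈ B) : optAlphaPair n r ρ σ ≤ v :=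
    (Real.le_biSup hopt (hle ρ hρ) hσ).trans
      (Real.le_biSup (f := fun ρ => ⨆ σ ∈ B, optAlphaPair n r ρ σ) hopt hle' hρ)
  have hv0 : 0 ≤ v := Real.biSup_nonneg fun ρ hρ => Real.biSup_nonneg fun σ _ =>
    optAlphaPair_nonneg (hAstate ρ hρ)
  obtain ⟨M, hM, hMA, hMB⟩ := exists_forall_le_of_forall_pair isCompact_setOf_isTest
    convex_setOf_isTest (-tracePairing d n) (fun X => (continuous_tracePairing X).neg)
    (tracePairing d n) continuous_tracePairing hAconv hBconv hAne hBne (v - 1)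
    ((2 : ℝ) ^ (-((n : ℝ) * r))) (fun ρ hρ σ hσ => by
      obtain ⟨M, hM, hMσ, hMρ⟩ := exists_isTest_optAlphaPair (hAstate ρ hρ) (hBstate σ hσ) r
      refine ⟨M, hM, ?_, hMσ⟩
      rw [(hAstate ρ hρ).trace_mul_one_sub_re] at hMρ
      rw [LinearMap.neg_apply, LinearMap.neg_apply, tracePairing_apply]
      linarith [hpair ρ hρ σ hσ])
  refine (optAlpha_le hAstate hM (Real.biSup_le (by positivity) hMB)).trans
    (Real.biSup_le hv0 fun ρ hρ => ?_)
  have := hMA ρ hρ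
  rw [LinearMap.neg_apply, LinearMap.neg_apply, tracePairing_apply] at this
  rw [(hAstate ρ hρ).trace_mul_one_sub_re]
  linarith

end
end

section
/- Let H be a finite-dimensional complex Hilbert space, n ∈ ℕ, r > 0, and α ∈ (0,1). For any quantum states ρ_n, σ_n on H^{⊗n} with supp(ρ_n) ⊆ supp(σ_n), there exists a test M with 0 ≤ M ≤ I such that tr[σ_n M] ≤ 2^{−nr} and tr[ρ_n (I − M)] ≤ 2^{((1−α)/α)·n·(r − (1/n) D_{P,α}(ρ_n‖σ_n))}. -/
open Filter Set
open scoped ComplexOrder Classical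

noncomputable section

namespace Matrix

open scoped MatrixOrder Matrix.Norms.L2Operator

variable {m : Type*} [Fintype m] [DecidableEq m]

lemma trace_mul_re_nonneg {A B : Matrix m m ℂ} (hA : 0 ≤ A) (hB : 0 ≤ B) :
    0 ≤ (A * B).trace.re := by
  have hS : (CFC.sqrt B)ᴴ = CFC.sqrt B := (CFC.sqrt_nonneg B).isSelfAdjoint
  have h := ((nonneg_iff_posSemidef.mp hA).conjTranspose_mul_mul_same (CFC.sqrt B)).trace_nonneg
  rw [hS, trace_mul_comm, ← mul_assoc, CFC.sqrt_mul_sqrt_self B hB, trace_mul_comm] at h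
  exact (Complex.nonneg_iff.mp h).1

lemma trace_mul_re_mono {A B C : Matrix m m ℂ} (hA : 0 ≤ A) (hBC : B ≤ C) :
    (A * B).trace.re ≤ (A * C).trace.re := by
  have h := trace_mul_re_nonneg hA (sub_nonneg.mpr hBC)
  rw [mul_sub, trace_sub, Complex.sub_re] at h
  linarith

lemma continuousOn_spectrum_real (f : ℝ → ℝ) (A : Matrix m m ℂ) :
    ContinuousOn f (spectrum ℝ A) :=
  A.finite_real_spectrum.continuousOn f

lemma rpow_mul_rpow_one_sub {A : Matrix m m ℂ} (hA : 0 ≤ A) {s : ℝ} (hs : s ∈ Set.Ioo (0 : ℝ) 1) :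
    A ^ s * A ^ (1 - s) = A := by
  rw [CFC.rpow_eq_cfc_real hA, CFC.rpow_eq_cfc_real hA,
    ← cfc_mul _ _ A (continuousOn_spectrum_real _ A) (continuousOn_spectrum_real _ A)]
  conv_rhs => rw [← cfc_id ℝ A]
  refine cfc_congr fun x hx => ?_
  have hx0 : 0 ≤ x := spectrum_nonneg_of_nonneg hA hx
  simp only [id]
  rw [← Real.rpow_add_of_nonneg hx0 hs.1.le (sub_nonneg.mpr hs.2.le), add_sub_cancel,
    Real.rpow_one]

lemma smul_rpow {A : Matrix m m ℂ} (hA : 0 ≤ A) {c : ℝ} (hc : 0 ≤ c) (s : ℝ) :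
    (c • A) ^ s = c ^ s • A ^ s := by
  rw [CFC.rpow_eq_cfc_real (smul_nonneg hc hA), CFC.rpow_eq_cfc_real hA,
    ← cfc_smul _ _ A (continuousOn_spectrum_real _ A),
    ← cfc_comp_smul c _ A ((A.finite_real_spectrum.image _).continuousOn _)]
  refine cfc_congr fun x hx => ?_
  simp only [smul_eq_mul]
  exact Real.mul_rpow hc (spectrum_nonneg_of_nonneg hA hx)

/-- The key step in Ozawa's proof of the quantum Chernoff inequality of Audenaert et al. -/
lemma trace_sub_le_trace_rpow_mul_rpow {A B P : Matrix m m ℂ} (hA : 0 ≤ A) (hB : 0 ≤ B)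
    (hP : 0 ≤ P) (hAB : A ≤ B + P) {s : ℝ} (hs : s ∈ Set.Ioo (0 : ℝ) 1) :
    A.trace.re - P.trace.re ≤ (A ^ s * B ^ (1 - s)).trace.re := by
  have hs' : 1 - s ∈ Set.Ioo (0 : ℝ) 1 := ⟨sub_pos.mpr hs.2, sub_lt_self _ hs.1⟩
  have hs_mem := Set.Ioo_subset_Icc_self hs
  have hs_mem' := Set.Ioo_subset_Icc_self hs'
  have hBC : B ≤ B + P := le_add_of_nonneg_right hP
  have hC : 0 ≤ B + P := hB.trans hBC
  have h₁ := trace_mul_re_mono (CFC.rpow_nonneg (a := A) (y := s))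
    (CFC.rpow_le_rpow hs_mem' hAB)
  have h₂ := trace_mul_re_mono (sub_nonneg.mpr (CFC.rpow_le_rpow hs_mem' hBC))
    (CFC.rpow_le_rpow hs_mem hAB)
  have h₃ := trace_mul_re_mono (CFC.rpow_nonneg (a := B) (y := 1 - s))
    (CFC.rpow_le_rpow hs_mem hBC)
  rw [trace_mul_comm, trace_mul_comm _ ((B + P) ^ s)] at h₂ h₃
  rw [rpow_mul_rpow_one_sub hA hs] at h₁
  rw [rpow_mul_rpow_one_sub hB hs] at h₃
  rw [mul_sub, mul_sub, rpow_mul_rpow_one_sub hC hs] at h₂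
  simp only [trace_sub, trace_add, Complex.sub_re, Complex.add_re] at h₂
  linarith

/-- The quantum Chernoff inequality of Audenaert et al., for the test `{A > B}`. -/
theorem exists_test_trace_add_trace_le {A B : Matrix m m ℂ} (hA : 0 ≤ A) (hB : 0 ≤ B)
    {s : ℝ} (hs : s ∈ Set.Ioo (0 : ℝ) 1) :
    ∃ M : Matrix m m ℂ, 0 ≤ M ∧ M ≤ 1 ∧
      (A * (1 - M)).trace.re + (B * M).trace.re ≤ (A ^ s * B ^ (1 - s)).trace.re := by
  have hD : IsSelfAdjoint (A - B) := hA.isSelfAdjoint.sub hB.isSelfAdjoint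
  have hcont := fun f : ℝ → ℝ => continuousOn_spectrum_real f (A - B)
  set f : ℝ → ℝ := fun x => if 0 < x then 1 else 0 with hf
  refine ⟨cfc f (A - B), cfc_nonneg fun x _ => ?_, cfc_le_one f _ fun x _ => ?_, ?_⟩
  · simp only [hf]; split_ifs <;> norm_num
  · simp only [hf]; split_ifs <;> norm_num
  have hP : (A - B) * cfc f (A - B) = cfc (fun x => x * f x) (A - B) := by
    rw [cfc_mul _ _ _ (hcont _) (hcont _), cfc_id' ℝ (A - B)]
  have hP_nonneg : 0 ≤ (A - B) * cfc f (A - B) := by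
    rw [hP]
    refine cfc_nonneg fun x _ => ?_
    simp only [hf]; split_ifs with hx
    · simpa using hx.le
    · simp
  have hP_ge : A - B ≤ (A - B) * cfc f (A - B) := by
    rw [hP]
    conv_lhs => rw [← cfc_id' ℝ (A - B)]
    refine cfc_mono (fun x _ => ?_) (hcont _) (hcont _)
    simp only [hf]; split_ifs with hx
    · simp
    · simpa using hx
  have h := trace_sub_le_trace_rpow_mul_rpow hA hB hP_nonneg (sub_le_iff_le_add'.mp hP_ge) hs
  rw [sub_mul, trace_sub, Complex.sub_re] at h
  rw [mul_sub, mul_one, trace_sub, Complex.sub_re]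
  linarith

end Matrix

open scoped MatrixOrder Matrix.Norms.L2Operator in
lemma mpow_eq_rpow {d n : ℕ} {A : Mat d n} (hA : A.PosSemidef) (p : ℝ) : mpow A p = A ^ p := by
  rw [CFC.rpow_eq_cfc_real hA.nonneg, hA.isHermitian.cfc_eq, mpow, dif_pos hA.isHermitian]
  rfl

open scoped MatrixOrder Matrix.Norms.L2Operator in
lemma qPetz_nonneg {d n : ℕ} (α : ℝ) {ρ σ : Mat d n} (hρ : ρ.PosSemidef) (hσ : σ.PosSemidef) :
    0 ≤ qPetz α ρ σ := by
  rw [qPetz, mpow_eq_rpow hρ, mpow_eq_rpow hσ]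
  exact Matrix.trace_mul_re_nonneg CFC.rpow_nonneg CFC.rpow_nonneg

open scoped MatrixOrder Matrix.Norms.L2Operator in
/-- The quantum Chernoff inequality, for the pair `ρ`, `c • σ`. -/
lemma exists_isTest_add_le_rpow_mul_qPetz {d n : ℕ} {α : ℝ} (hα : α ∈ Set.Ioo (0 : ℝ) 1)
    {ρ σ : Mat d n} (hρ : ρ.PosSemidef) (hσ : σ.PosSemidef) {c : ℝ} (hc : 0 < c) :
    ∃ M : Mat d n, IsTest M ∧ c * (σ * M).trace.re ≤ c ^ (1 - α) * qPetz α ρ σ ∧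
      (ρ * (1 - M)).trace.re ≤ c ^ (1 - α) * qPetz α ρ σ := by
  obtain ⟨M, hM, hM', h⟩ := Matrix.exists_test_trace_add_trace_le hρ.nonneg
    (smul_nonneg hc.le hσ.nonneg) hα
  rw [Matrix.smul_rpow hσ.nonneg hc.le, mul_smul_comm, smul_mul_assoc, Matrix.trace_smul,
    Matrix.trace_smul, Complex.smul_re, Complex.smul_re, smul_eq_mul, smul_eq_mul,
    ← mpow_eq_rpow hρ, ← mpow_eq_rpow hσ] at h
  have hρM := Matrix.trace_mul_re_nonneg hρ.nonneg (sub_nonneg.mpr hM')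
  have hσM := mul_nonneg hc.le (Matrix.trace_mul_re_nonneg hσ.nonneg hM)
  refine ⟨M, ⟨Matrix.nonneg_iff_posSemidef.mp hM, hM'⟩, ?_, ?_⟩ <;> rw [qPetz] <;> linarith

/-- Finite-blocklength achievability: for states `ρ_n, σ_n` with
`supp ρ_n ⊆ supp σ_n` and `α ∈ (0,1)`, there is a test with type-II error at most `2^{-nr}`
and type-I error at most `2^{((1-α)/α)·n·(r - (1/n)D_{P,α}(ρ_n‖σ_n))}`. -/
theorem finite_blocklength_achievability {d : ℕ} (n : ℕ) {r α : ℝ} (hr : 0 < r)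
    (hα : α ∈ Set.Ioo (0 : ℝ) 1) (ρ σ : Mat d n)
    (hρ : IsState ρ) (hσ : IsState σ) (hsupp : suppLE ρ σ) :
    ∃ M : Mat d n, IsTest M ∧
      (σ * M).trace.re ≤ (2 : ℝ) ^ (-((n : ℝ) * r)) ∧
      (ρ * (1 - M)).trace.re ≤
        (2 : ℝ) ^ ((1 - α) / α * (n : ℝ) *
          (r - (n : ℝ)⁻¹ * ((α - 1)⁻¹ * Real.logb 2 (qPetz α ρ σ)))) := by
  obtain ⟨hα0, hα1⟩ := hα
  rcases Nat.eq_zero_or_pos n with rfl | hn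
  · refine ⟨1, ⟨Matrix.PosSemidef.one, ?_⟩, ?_, ?_⟩
    · simpa using Matrix.PosSemidef.zero
    · simp [hσ.2]
    · simp
  have hn' : (n : ℝ) ≠ 0 := by positivity
  have hα' : α - 1 ≠ 0 := by linarith
  have h_exp : (1 - α) / α * (n : ℝ) *
      (r - (n : ℝ)⁻¹ * ((α - 1)⁻¹ * Real.logb 2 (qPetz α ρ σ))) =
      (1 - α) / α * (n * r) + Real.logb 2 (qPetz α ρ σ) / α := by
    field_simp
    ring
  rw [h_exp]
  rcases (qPetz_nonneg α hρ.1 hσ.1).eq_or_lt with hq | hq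
  · refine ⟨0, ⟨Matrix.PosSemidef.zero, ?_⟩, ?_, ?_⟩
    · simpa using Matrix.PosSemidef.one
    · simpa using Real.rpow_nonneg zero_le_two _
    · rw [sub_zero, mul_one, hρ.2, ← hq, Real.logb_zero, zero_div, add_zero, Complex.one_re]
      refine Real.one_le_rpow one_le_two ?_
      have := sub_pos.mpr hα1
      positivity
  set L := Real.logb 2 (qPetz α ρ σ)
  have hqL : qPetz α ρ σ = (2 : ℝ) ^ L := (Real.rpow_logb two_pos (by norm_num) hq).symm
  obtain ⟨M, hM, hσM, hρM⟩ := exists_isTest_add_le_rpow_mul_qPetz ⟨hα0, hα1⟩ hρ.1 hσ.1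
    (Real.rpow_pos_of_pos two_pos ((n * r + L) / α))
  rw [hqL, ← Real.rpow_mul zero_le_two, ← Real.rpow_add two_pos] at hσM hρM
  refine ⟨M, hM, ?_, hρM.trans_eq ?_⟩
  · refine le_of_mul_le_mul_left (hσM.trans_eq ?_)
      (Real.rpow_pos_of_pos two_pos ((n * r + L) / α))
    rw [← Real.rpow_add two_pos]
    congr 1
    field_simp
    ring
  · congr 1
    field_simp
    ring

end
end
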